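/- For every z ∈ ℂ and q ∈ ℝ, Σ_{n∈ℤ} ψₙ(z) conj(φₙ(q)) = (ν/π)^{3/4} e^{(ν/2)z² − ν(q/√2 − z)²} θ₃( (iν/π)(q/√2 − z) + α | iν/π ); equivalently, (ν/π)^{1/4} e^{(ν/2)z²} Σ_{n∈ℤ} e^{−(π²/ν)(n+α)² + 2πi(n+α)(z − q/√2)} = (ν/π)^{3/4} e^{(ν/2)z² − ν(q/√2 − z)²} Σ_{m∈ℤ} e^{−νm² + 2πim((iν/π)(q/√2 − z) + α)}. -/

import Mathlib

open Complex

/-- `φₙ(q) = 2^{−1/4} e^{√2 πi(n+α)q}`. -/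
noncomputable def phiN (α : ℝ) (n : ℤ) (q : ℝ) : ℂ :=
  ((2 : ℝ) ^ (-(1 : ℝ) / 4) : ℝ) *
    Complex.exp (Real.sqrt 2 * Real.pi * Complex.I * (α + n) * q)

/-- `ψₙ(z) = (2ν/π)^{1/4} e^{−(π²/ν)(n+α)²} e^{(ν/2)z² + 2πi(α+n)z}`. -/
noncomputable def psiN (α ν : ℝ) (n : ℤ) (z : ℂ) : ℂ :=
  (((2 * ν / Real.pi) ^ ((1 : ℝ) / 4) *
      Real.exp (-(Real.pi ^ 2 / ν) * (n + α) ^ 2) : ℝ) : ℂ) *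
    Complex.exp (ν / 2 * z ^ 2 + 2 * Real.pi * Complex.I * (α + n) * z)

/-- A shifted Gaussian sum over `ℤ` is a Jacobi theta function: the modular inversion formula. -/
lemma jacobiTheta₂_eq_tsum_shifted_gaussian {ν : ℝ} (hν : 0 < ν) (ξ : ℂ) :
    jacobiTheta₂ ξ (I * ν / Real.pi) =
      (((ν / Real.pi) ^ (-(1 : ℝ) / 2) : ℝ) : ℂ) *
        ∑' n : ℤ, Complex.exp (-(Real.pi ^ 2 / ν) * (n + ξ) ^ 2) := by
  have hπ : (Real.pi : ℂ) ≠ 0 := by exact_mod_cast Real.pi_ne_zero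
  have hν' : (ν : ℂ) ≠ 0 := by exact_mod_cast hν.ne'
  have hpos : 0 < ν / Real.pi := div_pos hν Real.pi_pos
  have hroot : 1 / (-I * (I * ν / Real.pi)) ^ (1 / 2 : ℂ) =
      (((ν / Real.pi) ^ (-(1 : ℝ) / 2) : ℝ) : ℂ) := by
    have hτ : -I * (I * ν / Real.pi) = ((ν / Real.pi : ℝ) : ℂ) := by
      push_cast
      linear_combination (-(ν : ℂ) / Real.pi) * I_mul_I
    rw [hτ, neg_div, Real.rpow_neg hpos.le, ofReal_inv, ofReal_cpow hpos.le]
    simp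
  rw [jacobiTheta₂_functional_equation, hroot, ← jacobiTheta₂_neg_left, jacobiTheta₂, mul_assoc,
    ← tsum_mul_left]
  congr 1
  refine tsum_congr fun n => ?_
  rw [jacobiTheta₂_term, ← Complex.exp_add]
  congr 1
  field_simp
  ring

/-- The product `ψₙ(z) conj(φₙ(q))` as a shifted Gaussian in `n`. -/
lemma psiN_mul_conj_phiN (α : ℝ) {ν : ℝ} (hν : 0 < ν) (n : ℤ) (z : ℂ) (q : ℝ) :
    psiN α ν n z * (starRingEnd ℂ) (phiN α n q) =
      (((ν / Real.pi) ^ ((1 : ℝ) / 4) : ℝ) : ℂ) *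
        Complex.exp (ν / 2 * z ^ 2 - ν * ((q : ℂ) / Real.sqrt 2 - z) ^ 2) *
        Complex.exp (-(Real.pi ^ 2 / ν) *
          (n + (I * ν / Real.pi * ((q : ℂ) / Real.sqrt 2 - z) + α)) ^ 2) := by
  have hπ : (Real.pi : ℂ) ≠ 0 := by exact_mod_cast Real.pi_ne_zero
  have hν' : (ν : ℂ) ≠ 0 := by exact_mod_cast hν.ne'
  have hsqrt : (Real.sqrt 2 : ℂ) = 2 / Real.sqrt 2 := by
    exact_mod_cast (Real.div_sqrt (x := 2)).symm
  have hconst : (2 * ν / Real.pi) ^ ((1 : ℝ) / 4) * (2 : ℝ) ^ (-(1 : ℝ) / 4) =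
      (ν / Real.pi) ^ ((1 : ℝ) / 4) := by
    rw [mul_div_assoc, Real.mul_rpow zero_le_two (div_pos hν Real.pi_pos).le, mul_right_comm,
      ← Real.rpow_add two_pos]
    norm_num
  have hexp : Complex.exp (-(Real.pi ^ 2 / ν) * (n + α) ^ 2) *
      Complex.exp (ν / 2 * z ^ 2 + 2 * Real.pi * I * (α + n) * z) *
      Complex.exp (Real.sqrt 2 * Real.pi * -I * (α + n) * q) =
      Complex.exp (ν / 2 * z ^ 2 - ν * ((q : ℂ) / Real.sqrt 2 - z) ^ 2) *
        Complex.exp (-(Real.pi ^ 2 / ν) *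
          (n + (I * ν / Real.pi * ((q : ℂ) / Real.sqrt 2 - z) + α)) ^ 2) := by
    simp only [← Complex.exp_add]
    congr 1
    rw [show (Real.sqrt 2 : ℂ) * Real.pi * -I * (α + n) * q =
      -(2 * Real.pi * I * (α + n) * (q / Real.sqrt 2)) by
        linear_combination (Real.pi * -I * (α + n) * q) * hsqrt]
    generalize (q : ℂ) / Real.sqrt 2 = w
    field_simp
    ring_nf
    simp only [I_sq]
    ring
  rw [psiN, phiN, ← hconst, mul_assoc _ (Complex.exp _) (Complex.exp _), ← hexp]
  simp only [map_mul, conj_ofReal, ← Complex.exp_conj, conj_I, map_add, map_intCast]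
  push_cast
  ring

/-- The bilateral generating function identity: for every `z ∈ ℂ` and `q ∈ ℝ`,
`Σ_{n∈ℤ} ψₙ(z) conj(φₙ(q)) = (ν/π)^{3/4} e^{(ν/2)z² − ν(q/√2 − z)²}
Σ_{m∈ℤ} e^{−νm² + 2πim((iν/π)(q/√2 − z) + α)}`, i.e. the sum equals
`(ν/π)^{3/4} e^{(ν/2)z² − ν(q/√2 − z)²} θ₃((iν/π)(q/√2 − z) + α | iν/π)`. -/
theorem stmt_15 (α ν : ℝ) (hν : 0 < ν) :
    ∀ (z : ℂ) (q : ℝ),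
      (∑' n : ℤ, psiN α ν n z * (starRingEnd ℂ) (phiN α n q))
        = (((ν / Real.pi) ^ ((3 : ℝ) / 4) : ℝ) : ℂ) *
            Complex.exp (ν / 2 * z ^ 2 - ν * ((q : ℂ) / Real.sqrt 2 - z) ^ 2) *
            ∑' m : ℤ, Complex.exp (-ν * (m : ℂ) ^ 2 +
              2 * Real.pi * Complex.I * (m : ℂ) *
                (Complex.I * ν / Real.pi * ((q : ℂ) / Real.sqrt 2 - z) + α)) := by
  intro z q
  have hpos : 0 < ν / Real.pi := div_pos hν Real.pi_pos
  have hconst : (ν / Real.pi) ^ ((3 : ℝ) / 4) * (ν / Real.pi) ^ (-(1 : ℝ) / 2) =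
      (ν / Real.pi) ^ ((1 : ℝ) / 4) := by
    rw [← Real.rpow_add hpos]
    norm_num
  have htheta (ξ : ℂ) : ∑' m : ℤ, Complex.exp (-ν * (m : ℂ) ^ 2 +
      2 * Real.pi * Complex.I * (m : ℂ) * ξ) = jacobiTheta₂ ξ (I * ν / Real.pi) := by
    refine tsum_congr fun m => ?_
    have hπ : (Real.pi : ℂ) ≠ 0 := by exact_mod_cast Real.pi_ne_zero
    rw [jacobiTheta₂_term]
    congr 1
    field_simp
    linear_combination -(ν * (m : ℂ) ^ 2) * I_sq
  simp only [psiN_mul_conj_phiN α hν]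
  rw [htheta, jacobiTheta₂_eq_tsum_shifted_gaussian hν, tsum_mul_left, ← hconst]
  push_cast
  ring
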